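/- arXiv:2604.13703 — 3 statements merged into one kernel-verified Lean document; each statement's English description precedes it below -/
import Mathlib

section
/- Define, for λ, D > 0, α, β > 0, L^{α,β}(t, x) := ∫₀^t ∫_{{|y| ≤ λs}} (1+t−s)^{−α} e^{−|x−y|²/(D(1+t−s))} (1+s)^{−β} B₃(s, |y|) dy ds. There exist constants C > 0 and D₁ ≥ 2D such that for all t ≥ 0 and x ∈ ℝ³, L^{α,β}(t, x) ≤ C ((1+t)^{−α} Γ_{β−3/2}(t) + (1+t)^{−β} Γ_{α−3/2}(t)) (e^{−3(|x|−λt)²/(2D₁(1+t))} + B₃(t, |x|) 1_{{|x| ≤ λt}}). -/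
open MeasureTheory Real
open scoped ENNReal

noncomputable section

abbrev E3 : Type := EuclideanSpace ℝ (Fin 3)

/-- The space–time diffusive profile `B_k(t,z) = (1 + z²/(1+t))^{-k}`. -/
def Bprof (k t z : ℝ) : ℝ := (1 + z ^ 2 / (1 + t)) ^ (-k)

/-- `Γ_α(t) = ∫₀ᵗ (1+s)^{-α} ds`. -/
def Gam (a t : ℝ) : ℝ := ∫ s in (0 : ℝ)..t, (1 + s) ^ (-a)

lemma Bprof_three (t z : ℝ) : Bprof 3 t z = ((1 + z ^ 2 / (1 + t)) ^ 3)⁻¹ := by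
  unfold Bprof
  rw [show (-3 : ℝ) = ((-3 : ℤ) : ℝ) by norm_num, Real.rpow_intCast]
  rfl

lemma Bprof_three_pos {t : ℝ} (ht : 0 ≤ t) (z : ℝ) : 0 < Bprof 3 t z := by
  rw [Bprof_three]; positivity

lemma Bprof_three_le_one {t : ℝ} (ht : 0 ≤ t) (z : ℝ) : Bprof 3 t z ≤ 1 := by
  rw [Bprof_three]
  apply inv_le_one_of_one_le₀
  apply one_le_pow₀
  have : 0 ≤ z ^ 2 / (1 + t) := by positivity
  linarith

lemma Bprof_three_le_mul {s t z r k : ℝ} (hs : 0 ≤ s) (ht : 0 ≤ t)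
    (h : 1 + r ^ 2 / (1 + t) ≤ k * (1 + z ^ 2 / (1 + s))) :
    Bprof 3 s z ≤ k ^ 3 * Bprof 3 t r := by
  rw [Bprof_three, Bprof_three]
  have h1 : 0 < 1 + r ^ 2 / (1 + t) := by positivity
  have h2 : 0 < 1 + z ^ 2 / (1 + s) := by positivity
  rw [← div_eq_mul_inv, le_div_iff₀ (by positivity), inv_mul_le_iff₀ (by positivity), ← mul_pow]
  rw [mul_comm] at h
  gcongr

lemma exists_exp_neg_le_Bprof_three {a : ℝ} (ha : 0 < a) :
    ∃ C ≥ (1 : ℝ), ∀ t r : ℝ, 0 ≤ t → Real.exp (-(a * (r ^ 2 / (1 + t)))) ≤ C * Bprof 3 t r := by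
  refine ⟨max 1 (6 * Real.exp a / a ^ 3), le_max_left _ _, fun t r ht => ?_⟩
  have hu : 0 ≤ r ^ 2 / (1 + t) := by positivity
  refine le_trans ?_ (mul_le_mul_of_nonneg_right (le_max_right _ _) (Bprof_three_pos ht r).le)
  rw [Bprof_three]
  set u := r ^ 2 / (1 + t)
  have h := Real.pow_div_factorial_le_exp (a * (1 + u)) (by positivity) 3
  rw [show a * (1 + u) = a + a * u by ring, Real.exp_add] at h
  rw [Real.exp_neg, ← div_eq_mul_inv, le_div_iff₀ (by positivity), inv_mul_le_iff₀ (by positivity),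
    ← mul_div_assoc, le_div_iff₀ (by positivity)]
  norm_num [Nat.factorial] at h
  nlinarith

lemma lintegral_exp_neg_norm_sub_sq_div (x : E3) {c : ℝ} (hc : 0 < c) :
    ∫⁻ y : E3, ENNReal.ofReal (Real.exp (-‖x - y‖ ^ 2 / c)) =
      ENNReal.ofReal ((π * c) ^ (3 / 2 : ℝ)) := by
  rw [lintegral_sub_left_eq_self (fun y : E3 => ENNReal.ofReal (Real.exp (-‖y‖ ^ 2 / c))) x]
  have h := GaussianFourier.integral_rexp_neg_mul_sq_norm (V := E3) (b := c⁻¹) (by positivity)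
  have hi : Integrable (fun v : E3 => Real.exp (-c⁻¹ * ‖v‖ ^ 2)) := by
    by_contra hcon
    rw [integral_undef hcon] at h
    have : 0 < (π / c⁻¹) ^ ((Module.finrank ℝ E3 : ℝ) / 2) := by positivity
    exact this.ne h
  have he : ∀ v : E3, -‖v‖ ^ 2 / c = -c⁻¹ * ‖v‖ ^ 2 := fun v => by ring
  simp_rw [he]
  rw [← ofReal_integral_eq_lintegral_ofReal hi (Filter.Eventually.of_forall fun _ => by positivity),
    h]
  simp

lemma exists_lintegral_Bprof_three_le :
    ∃ C > (0 : ℝ), ∀ s : ℝ, 0 ≤ s →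
      ∫⁻ y : E3, ENNReal.ofReal (Bprof 3 s ‖y‖) ≤ ENNReal.ofReal (C * (1 + s) ^ (3 / 2 : ℝ)) := by
  have hi : Integrable (fun y : E3 => (1 + ‖y‖ ^ 2) ^ (-(6 : ℝ) / 2)) :=
    integrable_rpow_neg_one_add_norm_sq (by simp; norm_num)
  refine ⟨(∫ y : E3, (1 + ‖y‖ ^ 2) ^ (-(6 : ℝ) / 2)) + 1, ?_, fun s hs => ?_⟩
  · have : 0 ≤ ∫ y : E3, (1 + ‖y‖ ^ 2) ^ (-(6 : ℝ) / 2) := integral_nonneg fun _ => by positivity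
    linarith
  have hR : 0 < (√(1 + s))⁻¹ := by positivity
  have hB : ∀ y : E3, Bprof 3 s ‖y‖ = (1 + ‖(√(1 + s))⁻¹ • y‖ ^ 2) ^ (-(6 : ℝ) / 2) := by
    intro y
    rw [norm_smul, Real.norm_of_nonneg hR.le, mul_pow, inv_pow, Real.sq_sqrt (by positivity),
      Bprof, div_eq_inv_mul]
    norm_num
  simp_rw [hB]
  rw [← ofReal_integral_eq_lintegral_ofReal (hi.comp_smul hR.ne')
    (Filter.Eventually.of_forall fun _ => by positivity)]
  apply ENNReal.ofReal_le_ofReal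
  rw [Measure.integral_comp_smul volume (fun y : E3 => (1 + ‖y‖ ^ 2) ^ (-(6 : ℝ) / 2))]
  have h3 : |((√(1 + s))⁻¹ ^ Module.finrank ℝ E3)⁻¹| = (1 + s) ^ (3 / 2 : ℝ) := by
    rw [abs_of_nonneg (by positivity), finrank_euclideanSpace_fin, inv_pow, inv_inv,
      Real.sqrt_eq_rpow, ← Real.rpow_natCast, ← Real.rpow_mul (by positivity)]
    norm_num
  rw [h3, smul_eq_mul, mul_comm]
  gcongr
  linarith

/-- The spatial envelope: a Gaussian around the cone `r = λt` plus `B₃` inside the cone. -/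
def coneEnvelope (lam D₁ t r : ℝ) : ℝ :=
  Real.exp (-3 * (r - lam * t) ^ 2 / (2 * D₁ * (1 + t))) +
    (if r ≤ lam * t then Bprof 3 t r else 0)

lemma coneEnvelope_nonneg (lam D₁ r : ℝ) {t : ℝ} (ht : 0 ≤ t) : 0 ≤ coneEnvelope lam D₁ t r := by
  unfold coneEnvelope
  have := (Bprof_three_pos ht r).le
  split_ifs <;> positivity

lemma Bprof_three_le_coneEnvelope {lam D₁ t r : ℝ} (h : r ≤ lam * t) :
    Bprof 3 t r ≤ coneEnvelope lam D₁ t r := by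
  unfold coneEnvelope
  rw [if_pos h]
  linarith [Real.exp_pos (-3 * (r - lam * t) ^ 2 / (2 * D₁ * (1 + t)))]

lemma exp_le_coneEnvelope_mul_exp {lam D s t d z r : ℝ} (hlam : 0 < lam) (hD : 0 < D) (hs : 0 ≤ s)
    (hst : s ≤ t) (hz : z ≤ lam * s) (hr : r ≤ d + z) (h : lam * t < r) :
    Real.exp (-d ^ 2 / (D * (1 + t - s))) ≤
      coneEnvelope lam (2 * D) t r * Real.exp (-d ^ 2 / (4 * D * (1 + t - s))) := by
  unfold coneEnvelope
  rw [if_neg h.not_ge, add_zero, ← Real.exp_add]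
  apply Real.exp_le_exp.2
  have h1 : 0 < 1 + t - s := by linarith
  have h2 : lam * s ≤ lam * t := by gcongr
  have h4 : (r - lam * t) ^ 2 / (1 + t) ≤ d ^ 2 / (1 + t - s) := by
    gcongr <;> linarith
  have e1 : -d ^ 2 / (D * (1 + t - s)) = -(d ^ 2 / (1 + t - s)) / D := by field_simp
  have e2 : -d ^ 2 / (4 * D * (1 + t - s)) = -(d ^ 2 / (1 + t - s)) / 4 / D := by field_simp
  have e3 : -3 * (r - lam * t) ^ 2 / (2 * (2 * D) * (1 + t)) =
      -3 / 4 * ((r - lam * t) ^ 2 / (1 + t)) / D := by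
    field_simp; ring
  rw [e1, e2, e3, ← add_div]
  gcongr
  linarith

lemma div_le_of_le_two_mul {D s t d r : ℝ} (hD : 0 < D) (hs : 0 ≤ s) (hst : s ≤ t) (hr0 : 0 ≤ r)
    (h : r ≤ 2 * d) : 1 / (16 * D) * (r ^ 2 / (1 + t)) ≤ d ^ 2 / (4 * D * (1 + t - s)) := by
  have h1 : 0 < 1 + t - s := by linarith
  have h2 : 1 / (16 * D) * (r ^ 2 / (1 + t)) = (r / 2) ^ 2 / (4 * D * (1 + t)) := by
    field_simp; ring
  rw [h2]
  have : 0 ≤ d := by linarith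
  gcongr <;> linarith

lemma one_add_div_le_four_mul {s t z r : ℝ} (hs : 0 ≤ s) (hst : s ≤ t) (hr0 : 0 ≤ r)
    (h : r ≤ 2 * z) : 1 + r ^ 2 / (1 + t) ≤ 4 * (1 + z ^ 2 / (1 + s)) := by
  have : r ^ 2 / (1 + t) ≤ (2 * z) ^ 2 / (1 + s) := by gcongr
  have e : (2 * z) ^ 2 / (1 + s) = 4 * (z ^ 2 / (1 + s)) := by ring
  linarith

lemma exists_exp_mul_Bprof_le_coneEnvelope_mul_exp {lam D : ℝ} (hlam : 0 < lam) (hD : 0 < D) :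
    ∃ C > (0 : ℝ), ∀ s t d z r : ℝ, 0 ≤ s → s ≤ t → z ≤ lam * s → 0 ≤ r →
      r ≤ d + z →
      Real.exp (-d ^ 2 / (D * (1 + t - s))) * Bprof 3 s z ≤
        C * coneEnvelope lam (2 * D) t r * Real.exp (-d ^ 2 / (4 * D * (1 + t - s))) := by
  obtain ⟨C₀, hC₀, hexp⟩ := exists_exp_neg_le_Bprof_three (a := 1 / (16 * D)) (by positivity)
  refine ⟨C₀ + 64, by positivity, fun s t d z r hs hst hz hr0 hr => ?_⟩
  have ht : 0 ≤ t := hs.trans hst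
  have h1 : 0 < 1 + t - s := by linarith
  have hE := coneEnvelope_nonneg lam (2 * D) r ht
  have hB1 := Bprof_three_le_one hs z
  have hB0 := (Bprof_three_pos hs z).le
  have hBt := (Bprof_three_pos ht r).le
  rcases lt_or_ge (lam * t) r with h | h
  · calc _ ≤ coneEnvelope lam (2 * D) t r * Real.exp (-d ^ 2 / (4 * D * (1 + t - s))) * 1 := by
          gcongr
          exact exp_le_coneEnvelope_mul_exp hlam hD hs hst hz hr h
      _ = 1 * coneEnvelope lam (2 * D) t r * Real.exp (-d ^ 2 / (4 * D * (1 + t - s))) := by ring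
      _ ≤ _ := by gcongr; linarith
  · have hBE := Bprof_three_le_coneEnvelope (D₁ := 2 * D) h
    have e1 : d ^ 2 / (D * (1 + t - s)) = 4 * (d ^ 2 / (4 * D * (1 + t - s))) := by
      field_simp
    have hq : 0 ≤ d ^ 2 / (4 * D * (1 + t - s)) := by positivity
    have hC : C₀ * Bprof 3 t r ≤ (C₀ + 64) * coneEnvelope lam (2 * D) t r := by
      gcongr; linarith
    have hC' : 4 ^ 3 * Bprof 3 t r ≤ (C₀ + 64) * coneEnvelope lam (2 * D) t r := by
      gcongr; linarith
    rw [neg_div, neg_div, e1]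
    rcases le_total r (2 * d) with hd | hd
    · have h5 := div_le_of_le_two_mul hD hs hst hr0 hd
      calc _ ≤ Real.exp (-(1 / (16 * D) * (r ^ 2 / (1 + t))) +
              -(d ^ 2 / (4 * D * (1 + t - s)))) * 1 := by
            gcongr; linarith
        _ ≤ C₀ * Bprof 3 t r * Real.exp (-(d ^ 2 / (4 * D * (1 + t - s)))) := by
            rw [Real.exp_add, mul_one]
            gcongr
            exact hexp t r ht
        _ ≤ _ := by gcongr
    · have h6 := Bprof_three_le_mul hs ht
        (one_add_div_le_four_mul (z := z) hs hst hr0 (by linarith))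
      rw [mul_comm]
      have h7 := h6.trans hC'
      gcongr
      linarith

lemma exists_exp_mul_Bprof_le_coneEnvelope_mul_add {lam D : ℝ} (hlam : 0 < lam) (hD : 0 < D) :
    ∃ C > (0 : ℝ), ∀ s t d z r : ℝ, 0 ≤ s → s ≤ t → z ≤ lam * s → 0 ≤ r →
      r ≤ d + z →
      Real.exp (-d ^ 2 / (D * (1 + t - s))) * Bprof 3 s z ≤
        C * coneEnvelope lam (2 * D) t r * (Bprof 3 s z +
          ((1 + s) / (1 + t)) ^ (3 / 2 : ℝ) * Real.exp (-d ^ 2 / (D * (1 + t)))) := by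
  obtain ⟨C₀, hC₀, hexp⟩ := exists_exp_neg_le_Bprof_three (a := 1 / (16 * D)) (by positivity)
  refine ⟨C₀ + 512, by positivity, fun s t d z r hs hst hz hr0 hr => ?_⟩
  have ht : 0 ≤ t := hs.trans hst
  have h1 : 0 < 1 + t - s := by linarith
  have hE := coneEnvelope_nonneg lam (2 * D) r ht
  have hB0 := (Bprof_three_pos hs z).le
  have hBt := (Bprof_three_pos ht r).le
  have hK : 0 ≤ ((1 + s) / (1 + t)) ^ (3 / 2 : ℝ) * Real.exp (-d ^ 2 / (D * (1 + t))) := by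
    positivity
  have of_exp_le : Real.exp (-d ^ 2 / (D * (1 + t - s))) ≤
      (C₀ + 512) * coneEnvelope lam (2 * D) t r →
      Real.exp (-d ^ 2 / (D * (1 + t - s))) * Bprof 3 s z ≤
        (C₀ + 512) * coneEnvelope lam (2 * D) t r * (Bprof 3 s z +
          ((1 + s) / (1 + t)) ^ (3 / 2 : ℝ) * Real.exp (-d ^ 2 / (D * (1 + t)))) := by
    intro h
    gcongr
    linarith
  have hneg : ∀ w : ℝ, 0 < w → Real.exp (-d ^ 2 / w) ≤ 1 := fun w hw => by
    rw [Real.exp_le_one_iff, neg_div, neg_nonpos]; positivity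
  rcases lt_or_ge (lam * t) r with h | h
  · apply of_exp_le
    calc _ ≤ _ := exp_le_coneEnvelope_mul_exp hlam hD hs hst hz hr h
      _ ≤ coneEnvelope lam (2 * D) t r * 1 := by
          gcongr
          exact hneg _ (by positivity)
      _ ≤ _ := by nlinarith
  have hBE := Bprof_three_le_coneEnvelope (D₁ := 2 * D) h
  rcases le_total (r ^ 2) (1 + t) with hrt | hrt
  · apply of_exp_le
    have h8 : Bprof 3 0 0 ≤ 2 ^ 3 * Bprof 3 t r := by
      apply Bprof_three_le_mul le_rfl ht
      have : r ^ 2 / (1 + t) ≤ 1 := by rw [div_le_one (by positivity)]; exact hrt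
      norm_num; linarith
    have h9 : Bprof 3 0 0 = 1 := by rw [Bprof_three]; norm_num
    have := hneg _ (mul_pos hD h1)
    nlinarith
  rcases le_total r (2 * d) with hd | hd
  · apply of_exp_le
    have h5 := div_le_of_le_two_mul hD hs hst hr0 hd
    have e1 : d ^ 2 / (D * (1 + t - s)) = 4 * (d ^ 2 / (4 * D * (1 + t - s))) := by
      field_simp
    have hq : 0 ≤ d ^ 2 / (4 * D * (1 + t - s)) := by positivity
    rw [neg_div, e1]
    calc _ ≤ Real.exp (-(1 / (16 * D) * (r ^ 2 / (1 + t)))) := Real.exp_le_exp.2 (by linarith)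
      _ ≤ C₀ * Bprof 3 t r := hexp t r ht
      _ ≤ _ := by gcongr; linarith
  · set q := (1 + s) / (1 + t) with hqdef
    have hq0 : 0 < q := by positivity
    have hq1 : q ≤ 1 := by rw [hqdef, div_le_one (by positivity)]; linarith
    have h6 : Bprof 3 s z ≤ (8 * q) ^ 3 * Bprof 3 t r := by
      apply Bprof_three_le_mul hs ht
      have a1 : 1 ≤ r ^ 2 / (1 + t) := by rw [le_div_iff₀ (by positivity)]; linarith
      have a2 : r ^ 2 / (1 + t) ≤ (2 * z) ^ 2 / (1 + t) := by gcongr; linarith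
      have a3 : 8 * q * (1 + z ^ 2 / (1 + s)) = 8 * q + 2 * ((2 * z) ^ 2 / (1 + t)) := by
        rw [hqdef]; field_simp; ring
      rw [a3]; linarith
    have hq3 : q ^ 3 ≤ q ^ (3 / 2 : ℝ) := by
      rw [← Real.rpow_natCast]
      apply Real.rpow_le_rpow_of_exponent_ge hq0 hq1
      norm_num
    have hG : Real.exp (-d ^ 2 / (D * (1 + t - s))) ≤ Real.exp (-d ^ 2 / (D * (1 + t))) := by
      rw [neg_div, neg_div]
      gcongr
      linarith
    calc _ ≤ Real.exp (-d ^ 2 / (D * (1 + t))) * ((8 * q) ^ 3 * Bprof 3 t r) := by gcongr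
      _ = 512 * Bprof 3 t r * (q ^ 3 * Real.exp (-d ^ 2 / (D * (1 + t)))) := by ring
      _ ≤ (C₀ + 512) * coneEnvelope lam (2 * D) t r *
          (q ^ (3 / 2 : ℝ) * Real.exp (-d ^ 2 / (D * (1 + t)))) := by
          gcongr; linarith
      _ ≤ _ := by gcongr; linarith

lemma rpow_neg_le_two_rpow_mul {a u v : ℝ} (ha : 0 < a) (hu : 0 < u) (h : u ≤ 2 * v) :
    v ^ (-a) ≤ 2 ^ a * u ^ (-a) := by
  have hv : 0 < v := by linarith
  calc v ^ (-a) ≤ (u / 2) ^ (-a) :=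
        Real.rpow_le_rpow_of_nonpos (by positivity) (by linarith) (by linarith)
    _ = 2 ^ a * u ^ (-a) := by
        rw [Real.div_rpow hu.le (by norm_num), Real.rpow_neg (by norm_num : (0 : ℝ) ≤ 2)]
        field_simp

/-- The spatial integral is controlled by `(1+t-s)^{3/2}`. -/
lemma exists_lintegral_le_coneEnvelope_mul_rpow_sub {lam D : ℝ} (hlam : 0 < lam) (hD : 0 < D) :
    ∃ C > (0 : ℝ), ∀ s t : ℝ, 0 ≤ s → s ≤ t → ∀ x : E3,
      ∫⁻ y in {y : E3 | ‖y‖ ≤ lam * s},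
        ENNReal.ofReal (Real.exp (-‖x - y‖ ^ 2 / (D * (1 + t - s))) * Bprof 3 s ‖y‖) ≤
      ENNReal.ofReal (C * coneEnvelope lam (2 * D) t ‖x‖ * (1 + t - s) ^ (3 / 2 : ℝ)) := by
  obtain ⟨C, hC, hbd⟩ := exists_exp_mul_Bprof_le_coneEnvelope_mul_exp hlam hD
  refine ⟨C * (π * (4 * D)) ^ (3 / 2 : ℝ), by positivity, fun s t hs hst x => ?_⟩
  have h1 : 0 < 1 + t - s := by linarith
  have hE := coneEnvelope_nonneg lam (2 * D) ‖x‖ (hs.trans hst)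
  have hS : MeasurableSet {y : E3 | ‖y‖ ≤ lam * s} :=
    measurableSet_le measurable_norm measurable_const
  calc _ ≤ ∫⁻ y in {y : E3 | ‖y‖ ≤ lam * s}, ENNReal.ofReal (C * coneEnvelope lam (2 * D) t ‖x‖) *
          ENNReal.ofReal (Real.exp (-‖x - y‖ ^ 2 / (4 * D * (1 + t - s)))) := by
        refine setLIntegral_mono' hS fun y hy => ?_
        rw [← ENNReal.ofReal_mul (by positivity)]
        exact ENNReal.ofReal_le_ofReal (hbd s t _ _ _ hs hst hy (norm_nonneg x)
          (norm_le_norm_sub_add x y))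
    _ ≤ ∫⁻ y, ENNReal.ofReal (C * coneEnvelope lam (2 * D) t ‖x‖) *
          ENNReal.ofReal (Real.exp (-‖x - y‖ ^ 2 / (4 * D * (1 + t - s)))) :=
        setLIntegral_le_lintegral _ _
    _ = _ := by
        rw [lintegral_const_mul' _ _ ENNReal.ofReal_ne_top,
          lintegral_exp_neg_norm_sub_sq_div x (by positivity), ← ENNReal.ofReal_mul (by positivity),
          ← mul_assoc π, Real.mul_rpow (by positivity) h1.le]
        ring_nf

/-- The spatial integral is controlled by `(1+s)^{3/2}`. -/
lemma exists_lintegral_le_coneEnvelope_mul_rpow {lam D : ℝ} (hlam : 0 < lam) (hD : 0 < D) :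
    ∃ C > (0 : ℝ), ∀ s t : ℝ, 0 ≤ s → s ≤ t → ∀ x : E3,
      ∫⁻ y in {y : E3 | ‖y‖ ≤ lam * s},
        ENNReal.ofReal (Real.exp (-‖x - y‖ ^ 2 / (D * (1 + t - s))) * Bprof 3 s ‖y‖) ≤
      ENNReal.ofReal (C * coneEnvelope lam (2 * D) t ‖x‖ * (1 + s) ^ (3 / 2 : ℝ)) := by
  obtain ⟨C, hC, hbd⟩ := exists_exp_mul_Bprof_le_coneEnvelope_mul_add hlam hD
  obtain ⟨C', hC', hB⟩ := exists_lintegral_Bprof_three_le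
  refine ⟨C * (C' + (π * D) ^ (3 / 2 : ℝ)), by positivity, fun s t hs hst x => ?_⟩
  have ht : 0 ≤ t := hs.trans hst
  have hE := coneEnvelope_nonneg lam (2 * D) ‖x‖ ht
  have hS : MeasurableSet {y : E3 | ‖y‖ ≤ lam * s} :=
    measurableSet_le measurable_norm measurable_const
  calc _ ≤ ∫⁻ y in {y : E3 | ‖y‖ ≤ lam * s}, ENNReal.ofReal (C * coneEnvelope lam (2 * D) t ‖x‖) *
          (ENNReal.ofReal (Bprof 3 s ‖y‖) + ENNReal.ofReal (((1 + s) / (1 + t)) ^ (3 / 2 : ℝ)) *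
          ENNReal.ofReal (Real.exp (-‖x - y‖ ^ 2 / (D * (1 + t))))) := by
        refine setLIntegral_mono' hS fun y hy => ?_
        have := (Bprof_three_pos hs ‖y‖).le
        rw [← ENNReal.ofReal_mul (by positivity), ← ENNReal.ofReal_add this (by positivity),
          ← ENNReal.ofReal_mul (by positivity)]
        exact ENNReal.ofReal_le_ofReal (hbd s t _ _ _ hs hst hy (norm_nonneg x)
          (norm_le_norm_sub_add x y))
    _ ≤ ∫⁻ y, ENNReal.ofReal (C * coneEnvelope lam (2 * D) t ‖x‖) *
          (ENNReal.ofReal (Bprof 3 s ‖y‖) + ENNReal.ofReal (((1 + s) / (1 + t)) ^ (3 / 2 : ℝ)) *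
          ENNReal.ofReal (Real.exp (-‖x - y‖ ^ 2 / (D * (1 + t))))) :=
        setLIntegral_le_lintegral _ _
    _ ≤ ENNReal.ofReal (C * coneEnvelope lam (2 * D) t ‖x‖) *
          (ENNReal.ofReal (C' * (1 + s) ^ (3 / 2 : ℝ)) +
            ENNReal.ofReal (((1 + s) / (1 + t)) ^ (3 / 2 : ℝ)) *
            ENNReal.ofReal ((π * (D * (1 + t))) ^ (3 / 2 : ℝ))) := by
        rw [lintegral_const_mul' _ _ ENNReal.ofReal_ne_top, lintegral_add_right _ (by fun_prop),
          lintegral_const_mul' _ _ ENNReal.ofReal_ne_top,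
          lintegral_exp_neg_norm_sub_sq_div x (by positivity)]
        gcongr
        exact hB s hs
    _ = _ := by
        rw [← ENNReal.ofReal_mul (by positivity), ← ENNReal.ofReal_add (by positivity)
          (by positivity), ← ENNReal.ofReal_mul (by positivity), ← Real.mul_rpow (by positivity)
          (by positivity)]
        have : (1 + s) / (1 + t) * (π * (D * (1 + t))) = π * D * (1 + s) := by field_simp
        rw [this, Real.mul_rpow (by positivity) (by positivity)]
        ring_nf

lemma exists_weighted_lintegral_le {α β lam D : ℝ} (hα : 0 < α) (hβ : 0 < β)
    (hlam : 0 < lam) (hD : 0 < D) :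
    ∃ C > (0 : ℝ), ∀ s t : ℝ, 0 ≤ s → s ≤ t → ∀ x : E3,
      ∫⁻ y in {y : E3 | ‖y‖ ≤ lam * s},
        ENNReal.ofReal ((1 + t - s) ^ (-α) *
            Real.exp (-‖x - y‖ ^ 2 / (D * (1 + t - s))) * (1 + s) ^ (-β) *
            Bprof 3 s ‖y‖) ≤
      ENNReal.ofReal (C * coneEnvelope lam (2 * D) t ‖x‖ *
        ((1 + t) ^ (-α) * (1 + s) ^ (-(β - 3 / 2)) +
          (1 + t) ^ (-β) * (1 + (t - s)) ^ (-(α - 3 / 2)))) := by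
  obtain ⟨C₁, hC₁, hb₁⟩ := exists_lintegral_le_coneEnvelope_mul_rpow hlam hD
  obtain ⟨C₂, hC₂, hb₂⟩ := exists_lintegral_le_coneEnvelope_mul_rpow_sub hlam hD
  refine ⟨2 ^ α * C₁ + 2 ^ β * C₂, by positivity, fun s t hs hst x => ?_⟩
  have ht : 0 ≤ t := hs.trans hst
  have h1 : 0 < 1 + t - s := by linarith
  have hE := coneEnvelope_nonneg lam (2 * D) ‖x‖ ht
  have hsplit : ∀ y : E3, ENNReal.ofReal ((1 + t - s) ^ (-α) *
      Real.exp (-‖x - y‖ ^ 2 / (D * (1 + t - s))) * (1 + s) ^ (-β) * Bprof 3 s ‖y‖) =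
      ENNReal.ofReal ((1 + t - s) ^ (-α) * (1 + s) ^ (-β)) *
      ENNReal.ofReal (Real.exp (-‖x - y‖ ^ 2 / (D * (1 + t - s))) * Bprof 3 s ‖y‖) := fun y => by
    rw [← ENNReal.ofReal_mul (by positivity)]
    ring_nf
  simp_rw [hsplit]
  rw [lintegral_const_mul' _ _ ENNReal.ofReal_ne_top]
  have e1 : (1 + s) ^ (-(β - 3 / 2)) = (1 + s) ^ (-β) * (1 + s) ^ (3 / 2 : ℝ) := by
    rw [← Real.rpow_add (by positivity)]; ring_nf
  have e2 : (1 + (t - s)) ^ (-(α - 3 / 2)) =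
      (1 + t - s) ^ (-α) * (1 + t - s) ^ (3 / 2 : ℝ) := by
    rw [← Real.rpow_add (by positivity), ← add_sub_assoc]; ring_nf
  rw [e1, e2]
  rcases le_total (2 * s) t with h | h
  · grw [hb₁ s t hs hst x]
    rw [← ENNReal.ofReal_mul (by positivity)]
    apply ENNReal.ofReal_le_ofReal
    have hw := rpow_neg_le_two_rpow_mul (u := 1 + t) (v := 1 + t - s) hα (by positivity)
      (by linarith)
    calc _ ≤ 2 ^ α * (1 + t) ^ (-α) * (1 + s) ^ (-β) *
          (C₁ * coneEnvelope lam (2 * D) t ‖x‖ * (1 + s) ^ (3 / 2 : ℝ)) := by gcongr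
      _ = 2 ^ α * C₁ * coneEnvelope lam (2 * D) t ‖x‖ *
          ((1 + t) ^ (-α) * ((1 + s) ^ (-β) * (1 + s) ^ (3 / 2 : ℝ))) := by ring
      _ ≤ _ := by
          gcongr
          · exact le_add_of_nonneg_right (by positivity)
          · exact le_add_of_nonneg_right (by positivity)
  · grw [hb₂ s t hs hst x]
    rw [← ENNReal.ofReal_mul (by positivity)]
    apply ENNReal.ofReal_le_ofReal
    have hw := rpow_neg_le_two_rpow_mul (u := 1 + t) (v := 1 + s) hβ (by positivity)
      (by linarith)
    calc _ ≤ (1 + t - s) ^ (-α) * (2 ^ β * (1 + t) ^ (-β)) *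
          (C₂ * coneEnvelope lam (2 * D) t ‖x‖ * (1 + t - s) ^ (3 / 2 : ℝ)) := by gcongr
      _ = 2 ^ β * C₂ * coneEnvelope lam (2 * D) t ‖x‖ *
          ((1 + t) ^ (-β) * ((1 + t - s) ^ (-α) * (1 + t - s) ^ (3 / 2 : ℝ))) := by ring
      _ ≤ _ := by
          gcongr
          · exact le_add_of_nonneg_left (by positivity)
          · exact le_add_of_nonneg_left (by positivity)

lemma intervalIntegrable_one_add_rpow (a : ℝ) {t : ℝ} (ht : 0 ≤ t) :
    IntervalIntegrable (fun s : ℝ => (1 + s) ^ a) volume 0 t := by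
  apply ContinuousOn.intervalIntegrable
  rw [Set.uIcc_of_le ht]
  refine ContinuousOn.rpow_const (by fun_prop) fun s hs => Or.inl ?_
  have := hs.1
  positivity

/-- Coupling of a Gaussian with the algebraic diffusive profile `B₃`: for
`α, β, λ, D > 0` there are `C > 0` and `D₁ ≥ 2D` such that
`L^{α,β}(t,x) = ∫₀ᵗ ∫_{|y|≤λs} (1+t-s)^{-α} e^{-|x-y|²/(D(1+t-s))} (1+s)^{-β} B₃(s,|y|) dy ds
  ≤ C ((1+t)^{-α} Γ_{β-3/2}(t) + (1+t)^{-β} Γ_{α-3/2}(t))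
      (e^{-3(|x|-λt)²/(2D₁(1+t))} + B₃(t,|x|) 1_{|x|≤λt})`. -/
theorem gaussian_profile_coupling (α β lam D : ℝ) (hα : 0 < α) (hβ : 0 < β)
    (hlam : 0 < lam) (hD : 0 < D) :
    ∃ C > (0 : ℝ), ∃ D₁ ≥ 2 * D, ∀ t : ℝ, 0 ≤ t → ∀ x : E3,
      (∫⁻ s in Set.Icc (0 : ℝ) t, ∫⁻ y in {y : E3 | ‖y‖ ≤ lam * s},
          ENNReal.ofReal ((1 + t - s) ^ (-α) *
            Real.exp (-‖x - y‖ ^ 2 / (D * (1 + t - s))) * (1 + s) ^ (-β) *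
            Bprof 3 s ‖y‖)) ≤
        ENNReal.ofReal (C * ((1 + t) ^ (-α) * Gam (β - 3 / 2) t +
            (1 + t) ^ (-β) * Gam (α - 3 / 2) t) *
          (Real.exp (-3 * (‖x‖ - lam * t) ^ 2 / (2 * D₁ * (1 + t))) +
            (if ‖x‖ ≤ lam * t then Bprof 3 t ‖x‖ else 0))) := by
  obtain ⟨C, hC, hbd⟩ := exists_weighted_lintegral_le hα hβ hlam hD
  refine ⟨C, hC, 2 * D, le_rfl, fun t ht x => ?_⟩
  have hE := coneEnvelope_nonneg lam (2 * D) ‖x‖ ht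
  have i1 : IntervalIntegrable (fun s : ℝ => (1 + t) ^ (-α) * (1 + s) ^ (-(β - 3 / 2)))
      volume 0 t := (intervalIntegrable_one_add_rpow _ ht).const_mul _
  have i2 : IntervalIntegrable (fun s : ℝ => (1 + t) ^ (-β) * (1 + (t - s)) ^ (-(α - 3 / 2)))
      volume 0 t := by
    have := (intervalIntegrable_one_add_rpow (-(α - 3 / 2)) ht).comp_sub_left t
    simp only [sub_zero, sub_self] at this
    exact this.symm.const_mul _
  have hGam : ∫ s in (0 : ℝ)..t, (1 + (t - s)) ^ (-(α - 3 / 2)) = Gam (α - 3 / 2) t := by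
    rw [intervalIntegral.integral_comp_sub_left (fun s => (1 + s) ^ (-(α - 3 / 2))) t, sub_self,
      sub_zero, Gam]
  have hint := (i1.add i2).const_mul (C * coneEnvelope lam (2 * D) t ‖x‖)
  rw [intervalIntegrable_iff_integrableOn_Icc_of_le ht] at hint
  calc _ ≤ ∫⁻ s in Set.Icc (0 : ℝ) t, ENNReal.ofReal (C * coneEnvelope lam (2 * D) t ‖x‖ *
        ((1 + t) ^ (-α) * (1 + s) ^ (-(β - 3 / 2)) +
          (1 + t) ^ (-β) * (1 + (t - s)) ^ (-(α - 3 / 2)))) :=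
        setLIntegral_mono' measurableSet_Icc fun s hs => hbd s t hs.1 hs.2 x
    _ = ENNReal.ofReal (∫ s in Set.Icc (0 : ℝ) t, C * coneEnvelope lam (2 * D) t ‖x‖ *
        ((1 + t) ^ (-α) * (1 + s) ^ (-(β - 3 / 2)) +
          (1 + t) ^ (-β) * (1 + (t - s)) ^ (-(α - 3 / 2)))) := by
        refine (ofReal_integral_eq_lintegral_ofReal hint ?_).symm
        refine (ae_restrict_iff' measurableSet_Icc).2 (Filter.Eventually.of_forall fun s hs => ?_)
        have h0 := hs.1
        have h1 : 0 ≤ t - s := sub_nonneg.2 hs.2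
        simp only [Pi.zero_apply]
        positivity
    _ = _ := by
        rw [integral_Icc_eq_integral_Ioc, ← intervalIntegral.integral_of_le ht,
          intervalIntegral.integral_const_mul, intervalIntegral.integral_add i1 i2,
          intervalIntegral.integral_const_mul, intervalIntegral.integral_const_mul, hGam, ← Gam,
          coneEnvelope]
        ring_nf

end
end

section
/- Define, for λ > 0 and α, β > 0, K^{α,β}(t, x) := ∫₀^t ∫_{{|x−y| ≤ λ(t−s)}} (1+t−s)^{−α} B_{3/2}(t−s, |x−y|) (1+s)^{−β} B₃(s, |y|) 1_{{|y| ≤ λs}} dy ds. There exists a constant C > 0 such that for all t ≥ 0 and x ∈ ℝ³, K^{α,β}(t, x) ≤ C ((1+t)^{−α} Γ_{β−3/2}(t) + (1+t)^{−β} Γ_{α−3/2}(t)) ln(1+t) · B_{3/2}(t, |x|) 1_{{|x| ≤ λt}}. -/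
open MeasureTheory Real
open scoped ENNReal

noncomputable section

lemma Bprof_nonneg {k t : ℝ} (z : ℝ) (ht : 0 ≤ t) : 0 ≤ Bprof k t z := by
  unfold Bprof; positivity

lemma measurable_Bprof (k t : ℝ) : Measurable (Bprof k t) := by
  unfold Bprof; fun_prop

lemma Bprof_le_Bprof {k l t : ℝ} (z : ℝ) (ht : 0 ≤ t) (h : k ≤ l) :
    Bprof l t z ≤ Bprof k t z := by
  unfold Bprof
  have : 0 ≤ z ^ 2 / (1 + t) := by positivity
  exact rpow_le_rpow_of_exponent_le (by linarith) (by linarith)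

lemma rpow_neg_le_of_le_mul {X Q c k : ℝ} (hX : 0 < X) (hQ : 0 < Q) (hc : 0 < c) (hk : 0 ≤ k)
    (h : X ≤ c * Q) : Q ^ (-k) ≤ c ^ k * X ^ (-k) := by
  have h1 : X ^ k ≤ c ^ k * Q ^ k := by
    rw [← mul_rpow hc.le hQ.le]
    exact rpow_le_rpow hX.le h hk
  rw [rpow_neg hQ.le, rpow_neg hX.le, ← div_eq_mul_inv, le_div_iff₀ (by positivity),
    inv_mul_le_iff₀ (by positivity)]
  linarith

/-- The product of two diffusive profiles at complementary times is controlled by the profile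
at the total time. -/
lemma Bprof_mul_Bprof_le {k u s a b z : ℝ} (hk : 0 ≤ k) (hu : 0 ≤ u) (hs : 0 ≤ s)
    (hz : 0 ≤ z) (hzab : z ≤ a + b) :
    Bprof k u a * Bprof k s b ≤ Bprof k (u + s) z *
      ((4 * ((1 + s) / (1 + (u + s)))) ^ k * Bprof k u a +
        (4 * ((1 + u) / (1 + (u + s)))) ^ k * Bprof k s b) := by
  have hP := Bprof_nonneg (k := k) a hu
  have hQ := Bprof_nonneg (k := k) b hs
  have hX := Bprof_nonneg (k := k) z (add_nonneg hu hs)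
  have key : 1 + z ^ 2 / (1 + (u + s)) ≤
      2 * ((1 + s) / (1 + (u + s)) * (1 + b ^ 2 / (1 + s)) +
        (1 + u) / (1 + (u + s)) * (1 + a ^ 2 / (1 + u))) := by
    have e : 2 * ((1 + s) / (1 + (u + s)) * (1 + b ^ 2 / (1 + s)) +
        (1 + u) / (1 + (u + s)) * (1 + a ^ 2 / (1 + u))) =
        2 * (1 + s + b ^ 2 + (1 + u + a ^ 2)) / (1 + (u + s)) := by
      field_simp
    have e' : 1 + z ^ 2 / (1 + (u + s)) = (1 + (u + s) + z ^ 2) / (1 + (u + s)) := by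
      field_simp
    rw [e, e']
    gcongr
    nlinarith [sq_nonneg (a - b), pow_le_pow_left₀ hz hzab 2]
  rcases le_total ((1 + u) / (1 + (u + s)) * (1 + a ^ 2 / (1 + u)))
    ((1 + s) / (1 + (u + s)) * (1 + b ^ 2 / (1 + s))) with h | h
  · have h1 : Bprof k s b ≤ (4 * ((1 + s) / (1 + (u + s)))) ^ k * Bprof k (u + s) z :=
      rpow_neg_le_of_le_mul (by positivity) (by positivity) (by positivity) hk (by linarith)
    have h2 : 0 ≤ Bprof k (u + s) z * ((4 * ((1 + u) / (1 + (u + s)))) ^ k * Bprof k s b) := by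
      positivity
    nlinarith [mul_le_mul_of_nonneg_left h1 hP]
  · have h1 : Bprof k u a ≤ (4 * ((1 + u) / (1 + (u + s)))) ^ k * Bprof k (u + s) z :=
      rpow_neg_le_of_le_mul (by positivity) (by positivity) (by positivity) hk (by linarith)
    have h2 : 0 ≤ Bprof k (u + s) z * ((4 * ((1 + s) / (1 + (u + s)))) ^ k * Bprof k u a) := by
      positivity
    nlinarith [mul_le_mul_of_nonneg_right h1 hQ]

lemma log_one_add_mul_le {c s : ℝ} (hc : 0 ≤ c) (hs : 0 ≤ s) :
    log (1 + c * s) ≤ (1 + c) * log (1 + s) := by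
  rw [← log_rpow (by positivity)]
  refine log_le_log (by positivity) ?_
  have := one_add_mul_self_le_rpow_one_add (s := s) (by linarith) (p := 1 + c) (by linarith)
  linarith

lemma sq_mul_Bprof_le {s r : ℝ} (hs : 0 ≤ s) (hr : 0 ≤ r) :
    r ^ 2 * Bprof (3 / 2) s r ≤
      (1 + s) ^ (3 / 2 : ℝ) * (r / (1 + s) / (1 + r ^ 2 / (1 + s))) := by
  unfold Bprof
  set w := 1 + r ^ 2 / (1 + s) with hw
  have hw0 : 0 < w := by positivity
  have h1 : w ^ (-(3 / 2) : ℝ) = w⁻¹ * (√w)⁻¹ := by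
    rw [sqrt_eq_rpow, ← rpow_neg_one, ← rpow_neg hw0.le, ← rpow_add hw0]; norm_num
  have h2 : (1 + s) ^ (3 / 2 : ℝ) = (1 + s) * √(1 + s) := by
    rw [sqrt_eq_rpow, ← rpow_one_add' (by linarith) (by norm_num)]; norm_num
  have h3 : r ≤ √(1 + s) * √w := by
    rw [← sqrt_mul (by positivity)]
    refine le_sqrt_of_sq_le ?_
    rw [hw]; field_simp; linarith
  have h4 : 0 < √w := sqrt_pos.2 hw0
  rw [h1, h2]
  have e1 : r ^ 2 * (w⁻¹ * (√w)⁻¹) = (r / w / √w) * r := by field_simp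
  have e2 : (1 + s) * √(1 + s) * (r / (1 + s) / w) = (r / w / √w) * (√(1 + s) * √w) := by
    field_simp
  rw [e1, e2]
  gcongr

lemma integral_sq_mul_Bprof_le {s R : ℝ} (hs : 0 ≤ s) (hR : 0 ≤ R) :
    ∫ r in (0 : ℝ)..R, r ^ 2 * Bprof (3 / 2) s r ≤
      (1 + s) ^ (3 / 2 : ℝ) * log (1 + R ^ 2 / (1 + s)) := by
  have hpos : ∀ r : ℝ, 0 < 1 + r ^ 2 / (1 + s) := fun r => by positivity
  have hcB : Continuous fun r : ℝ => r ^ 2 * Bprof (3 / 2) s r := by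
    unfold Bprof
    exact (continuous_id.pow 2).mul
      (Continuous.rpow_const (by fun_prop) fun r => Or.inl (hpos r).ne')
  have hc : Continuous fun r : ℝ => r / (1 + s) / (1 + r ^ 2 / (1 + s)) :=
    Continuous.div (by fun_prop) (by fun_prop) fun r => (hpos r).ne'
  have hd : ∀ r : ℝ, HasDerivAt (fun r : ℝ => 1 / 2 * log (1 + r ^ 2 / (1 + s)))
      (r / (1 + s) / (1 + r ^ 2 / (1 + s))) r := by
    intro r
    have h := ((((hasDerivAt_pow 2 r).div_const (1 + s)).const_add 1).log
      (hpos r).ne').const_mul (1 / 2)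
    convert! h using 1
    simp; ring
  calc ∫ r in (0 : ℝ)..R, r ^ 2 * Bprof (3 / 2) s r
      ≤ ∫ r in (0 : ℝ)..R, (1 + s) ^ (3 / 2 : ℝ) * (r / (1 + s) / (1 + r ^ 2 / (1 + s))) :=
        intervalIntegral.integral_mono_on hR (hcB.intervalIntegrable _ _)
          ((hc.const_mul _).intervalIntegrable _ _) fun r hr => sq_mul_Bprof_le hs hr.1
    _ = (1 + s) ^ (3 / 2 : ℝ) * (1 / 2 * log (1 + R ^ 2 / (1 + s))) := by
        rw [intervalIntegral.integral_const_mul,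
          intervalIntegral.integral_eq_sub_of_hasDerivAt (fun r _ => hd r)
            (hc.intervalIntegrable _ _)]
        simp
    _ ≤ _ := by
        have : 0 ≤ log (1 + R ^ 2 / (1 + s)) := log_nonneg (by
          have : 0 ≤ R ^ 2 / (1 + s) := by positivity
          linarith)
        gcongr
        linarith

lemma setLIntegral_Bprof_le {s R : ℝ} (hs : 0 ≤ s) (hR : 0 ≤ R) :
    ∫⁻ y in {y : E3 | ‖y‖ ≤ R}, ENNReal.ofReal (Bprof (3 / 2) s ‖y‖) ≤
      ENNReal.ofReal (3 * volume.real (Metric.ball (0 : E3) 1) *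
        ((1 + s) ^ (3 / 2 : ℝ) * log (1 + R ^ 2 / (1 + s)))) := by
  have hS : {y : E3 | ‖y‖ ≤ R} = Metric.closedBall (0 : E3) R := by ext; simp
  have hcont : Continuous fun y : E3 => Bprof (3 / 2) s ‖y‖ := by
    unfold Bprof
    refine Continuous.rpow_const (by fun_prop) fun y => Or.inl ?_
    positivity
  have hint : IntegrableOn (fun y : E3 => Bprof (3 / 2) s ‖y‖) (Metric.closedBall (0 : E3) R) :=
    hcont.continuousOn.integrableOn_compact (isCompact_closedBall _ _)
  rw [hS, ← ofReal_integral_eq_lintegral_ofReal hint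
    (Filter.Eventually.of_forall fun y => Bprof_nonneg _ hs)]
  refine ENNReal.ofReal_le_ofReal ?_
  have h1 : ∫ y in Metric.closedBall (0 : E3) R, Bprof (3 / 2) s ‖y‖ =
      ∫ y : E3, (Set.Iic R).indicator (Bprof (3 / 2) s) ‖y‖ := by
    rw [← integral_indicator Metric.isClosed_closedBall.measurableSet]
    congr 1
    ext y
    by_cases h : ‖y‖ ≤ R <;> simp [Set.indicator, h]
  have h2 : ∫ r in Set.Ioi (0 : ℝ), r ^ 2 • (Set.Iic R).indicator (Bprof (3 / 2) s) r =
      ∫ r in (0 : ℝ)..R, r ^ 2 * Bprof (3 / 2) s r := by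
    rw [intervalIntegral.integral_of_le hR, ← Set.Ioi_inter_Iic,
      ← setIntegral_indicator measurableSet_Iic]
    congr 1
    ext r
    by_cases h : r ≤ R <;> simp [h]
  rw [h1, integral_fun_norm_addHaar]
  simp only [finrank_euclideanSpace, Fintype.card_fin, Nat.add_one_sub_one]
  rw [h2, nsmul_eq_mul, smul_eq_mul, ← mul_assoc]
  have := integral_sq_mul_Bprof_le hs hR
  push_cast
  gcongr

lemma exists_setLIntegral_Bprof_le {lam : ℝ} (hlam : 0 < lam) :
    ∃ M > (0 : ℝ), ∀ s t : ℝ, 0 ≤ s → s ≤ t →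
      ∫⁻ y in {y : E3 | ‖y‖ ≤ lam * s}, ENNReal.ofReal (Bprof (3 / 2) s ‖y‖) ≤
        ENNReal.ofReal (M * ((1 + s) ^ (3 / 2 : ℝ) * log (1 + t))) := by
  have hv : 0 < volume.real (Metric.ball (0 : E3) 1) :=
    ENNReal.toReal_pos (Metric.measure_ball_pos _ _ one_pos).ne' measure_ball_lt_top.ne
  refine ⟨3 * volume.real (Metric.ball (0 : E3) 1) * (1 + lam ^ 2), by positivity,
    fun s t hs hst => (setLIntegral_Bprof_le hs (by positivity)).trans
      (ENNReal.ofReal_le_ofReal ?_)⟩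
  have h1 : log (1 + (lam * s) ^ 2 / (1 + s)) ≤ (1 + lam ^ 2) * log (1 + t) := by
    calc log (1 + (lam * s) ^ 2 / (1 + s)) ≤ log (1 + lam ^ 2 * s) := by
          refine log_le_log (by positivity) ?_
          gcongr
          rw [div_le_iff₀ (by positivity)]
          nlinarith [mul_nonneg (sq_nonneg lam) hs]
      _ ≤ (1 + lam ^ 2) * log (1 + s) := log_one_add_mul_le (by positivity) hs
      _ ≤ _ := by gcongr
  calc _ ≤ 3 * volume.real (Metric.ball (0 : E3) 1) *
      ((1 + s) ^ (3 / 2 : ℝ) * ((1 + lam ^ 2) * log (1 + t))) := by gcongr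
    _ = _ := by ring

lemma time_weight_le_of_le {k α β u s : ℝ} (hk : 0 ≤ k) (hα : 0 < α)
    (hs : 0 ≤ s) (hsu : s ≤ u) :
    (1 + u) ^ (-α) * (1 + s) ^ (-β) * ((1 + u) ^ k * ((1 + s) / (1 + (u + s))) ^ k) ≤
      2 ^ α * ((1 + (u + s)) ^ (-α) * (1 + s) ^ (-(β - k))) := by
  have hu : 0 ≤ u := hs.trans hsu
  have h1 : (1 + u) ^ (-α) ≤ 2 ^ α * (1 + (u + s)) ^ (-α) :=
    rpow_neg_le_of_le_mul (by positivity) (by positivity) two_pos hα.le (by linarith)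
  have h2 : (1 + u) ^ k * ((1 + s) / (1 + (u + s))) ^ k ≤ (1 + s) ^ k := by
    rw [← mul_rpow (by positivity) (by positivity)]
    refine rpow_le_rpow (by positivity) ?_ hk
    rw [← mul_div_assoc, div_le_iff₀ (by positivity)]
    nlinarith [mul_nonneg hu hs]
  have h3 : (1 + s) ^ (-(β - k)) = (1 + s) ^ (-β) * (1 + s) ^ k := by
    rw [← rpow_add (by positivity)]; ring_nf
  calc _ ≤ 2 ^ α * (1 + (u + s)) ^ (-α) * (1 + s) ^ (-β) * (1 + s) ^ k := by gcongr
    _ = _ := by rw [h3]; ring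

lemma time_weight_le {k α β u s : ℝ} (hk : 0 ≤ k) (hα : 0 < α) (hβ : 0 < β)
    (hu : 0 ≤ u) (hs : 0 ≤ s) :
    (1 + u) ^ (-α) * (1 + s) ^ (-β) * ((1 + u) ^ k * ((1 + s) / (1 + (u + s))) ^ k) ≤
      (2 ^ α + 2 ^ β) * ((1 + (u + s)) ^ (-α) * (1 + s) ^ (-(β - k)) +
        (1 + (u + s)) ^ (-β) * (1 + u) ^ (-(α - k))) := by
  have p1 : 0 ≤ (1 + (u + s)) ^ (-α) * (1 + s) ^ (-(β - k)) := by positivity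
  have p2 : 0 ≤ (1 + (u + s)) ^ (-β) * (1 + u) ^ (-(α - k)) := by positivity
  have p3 : (0 : ℝ) < 2 ^ α := by positivity
  have p4 : (0 : ℝ) < 2 ^ β := by positivity
  rcases le_total s u with h | h
  · have := time_weight_le_of_le (β := β) hk hα hs h
    nlinarith [mul_nonneg p4.le p1, mul_nonneg p3.le p2, mul_nonneg p4.le p2]
  · have := time_weight_le_of_le (β := α) hk hβ hu h
    have e : (1 + u) ^ k * ((1 + s) / (1 + (u + s))) ^ k =
        (1 + s) ^ k * ((1 + u) / (1 + (s + u))) ^ k := by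
      rw [← mul_rpow (by positivity) (by positivity), ← mul_rpow (by positivity) (by positivity)]
      congr 1; rw [add_comm u s]; ring
    rw [e, mul_comm ((1 + u) ^ (-α))]
    rw [add_comm s u] at this ⊢
    nlinarith [mul_nonneg p3.le p1, mul_nonneg p3.le p2, mul_nonneg p4.le p1]

/-- The spatial integral in the coupling, at fixed times `u = t - s` and `s`. -/
lemma exists_spatial_coupling_le {α β lam : ℝ} (hα : 0 < α) (hβ : 0 < β) (hlam : 0 < lam) :
    ∃ C > (0 : ℝ), ∀ u s : ℝ, 0 ≤ u → 0 ≤ s → ∀ x : E3,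
      ∫⁻ y in {y : E3 | ‖x - y‖ ≤ lam * u ∧ ‖y‖ ≤ lam * s},
          ENNReal.ofReal ((1 + u) ^ (-α) * Bprof (3 / 2) u ‖x - y‖ *
            (1 + s) ^ (-β) * Bprof 3 s ‖y‖) ≤
        ENNReal.ofReal (C * log (1 + (u + s)) * Bprof (3 / 2) (u + s) ‖x‖ *
          ((1 + (u + s)) ^ (-α) * (1 + s) ^ (-(β - 3 / 2)) +
            (1 + (u + s)) ^ (-β) * (1 + u) ^ (-(α - 3 / 2)))) := by
  obtain ⟨M, hM, hJ⟩ := exists_setLIntegral_Bprof_le hlam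
  refine ⟨2 * M * 4 ^ (3 / 2 : ℝ) * (2 ^ α + 2 ^ β), by positivity, fun u s hu hs x => ?_⟩
  set k : ℝ := 3 / 2 with hk
  have hk0 : 0 ≤ k := by norm_num [hk]
  set L := log (1 + (u + s))
  have hL : 0 ≤ L := log_nonneg (by linarith)
  set X := Bprof k (u + s) ‖x‖
  have hX : 0 ≤ X := Bprof_nonneg _ (by positivity)
  set W := (1 + u) ^ (-α) * (1 + s) ^ (-β) with hW
  have hW0 : 0 ≤ W := by positivity
  set c := (4 * ((1 + s) / (1 + (u + s)))) ^ k with hc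
  set d := (4 * ((1 + u) / (1 + (u + s)))) ^ k with hd
  have hc0 : 0 ≤ c := by positivity
  have hd0 : 0 ≤ d := by positivity
  have hpt : ∀ y : E3, ENNReal.ofReal ((1 + u) ^ (-α) * Bprof k u ‖x - y‖ *
      (1 + s) ^ (-β) * Bprof 3 s ‖y‖) ≤
      ENNReal.ofReal (W * X * c) * ENNReal.ofReal (Bprof k u ‖x - y‖) +
        ENNReal.ofReal (W * X * d) * ENNReal.ofReal (Bprof k s ‖y‖) := by
    intro y
    have hP := Bprof_nonneg (k := k) ‖x - y‖ hu
    have hQ := Bprof_nonneg (k := k) ‖y‖ hs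
    rw [← ENNReal.ofReal_mul (by positivity), ← ENNReal.ofReal_mul (by positivity),
      ← ENNReal.ofReal_add (by positivity) (by positivity)]
    refine ENNReal.ofReal_le_ofReal ?_
    have hz : ‖x‖ ≤ ‖x - y‖ + ‖y‖ := by simpa using norm_add_le (x - y) y
    calc (1 + u) ^ (-α) * Bprof k u ‖x - y‖ * (1 + s) ^ (-β) * Bprof 3 s ‖y‖
        = W * (Bprof k u ‖x - y‖ * Bprof 3 s ‖y‖) := by rw [hW]; ring
      _ ≤ W * (Bprof k u ‖x - y‖ * Bprof k s ‖y‖) := by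
          gcongr
          exact Bprof_le_Bprof _ hs (by norm_num [hk])
      _ ≤ W * (X * (c * Bprof k u ‖x - y‖ + d * Bprof k s ‖y‖)) := by
          exact mul_le_mul_of_nonneg_left
            (Bprof_mul_Bprof_le hk0 hu hs (norm_nonneg x) hz) hW0
      _ = _ := by ring
  have hmP : Measurable fun y : E3 => ENNReal.ofReal (Bprof k u ‖x - y‖) :=
    ((measurable_Bprof k u).comp (by fun_prop)).ennreal_ofReal
  have hmQ : Measurable fun y : E3 => ENNReal.ofReal (Bprof k s ‖y‖) :=
    ((measurable_Bprof k s).comp (by fun_prop)).ennreal_ofReal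
  have hIQ : ∫⁻ y in {y : E3 | ‖x - y‖ ≤ lam * u ∧ ‖y‖ ≤ lam * s},
      ENNReal.ofReal (Bprof k s ‖y‖) ≤ ENNReal.ofReal (M * ((1 + s) ^ k * L)) :=
    (lintegral_mono_set fun y hy => hy.2).trans (hJ s (u + s) hs (by linarith))
  have hIP : ∫⁻ y in {y : E3 | ‖x - y‖ ≤ lam * u ∧ ‖y‖ ≤ lam * s},
      ENNReal.ofReal (Bprof k u ‖x - y‖) ≤ ENNReal.ofReal (M * ((1 + u) ^ k * L)) := by
    refine le_trans ?_ (hJ u (u + s) hu (by linarith))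
    have hms : MeasurableSet {y : E3 | ‖y‖ ≤ lam * u} :=
      measurableSet_le (by fun_prop) (by fun_prop)
    have hms' : MeasurableSet {y : E3 | ‖x - y‖ ≤ lam * u} :=
      measurableSet_le (by fun_prop) (by fun_prop)
    refine (lintegral_mono_set (t := {y : E3 | ‖x - y‖ ≤ lam * u}) fun y hy => hy.1).trans ?_
    rw [← lintegral_indicator hms, ← lintegral_indicator hms',
      ← lintegral_sub_left_eq_self (μ := (volume : Measure E3))
        ({y : E3 | ‖y‖ ≤ lam * u}.indicator _) x]
    rfl
  calc _ ≤ ∫⁻ y in {y : E3 | ‖x - y‖ ≤ lam * u ∧ ‖y‖ ≤ lam * s},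
        (ENNReal.ofReal (W * X * c) * ENNReal.ofReal (Bprof k u ‖x - y‖) +
          ENNReal.ofReal (W * X * d) * ENNReal.ofReal (Bprof k s ‖y‖)) := lintegral_mono hpt
    _ ≤ ENNReal.ofReal (W * X * c) * ENNReal.ofReal (M * ((1 + u) ^ k * L)) +
        ENNReal.ofReal (W * X * d) * ENNReal.ofReal (M * ((1 + s) ^ k * L)) := by
        rw [lintegral_add_left (hmP.const_mul _), lintegral_const_mul _ hmP,
          lintegral_const_mul _ hmQ]
        gcongr
    _ = ENNReal.ofReal (W * X * c * (M * ((1 + u) ^ k * L)) +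
          W * X * d * (M * ((1 + s) ^ k * L))) := by
        rw [← ENNReal.ofReal_mul (by positivity), ← ENNReal.ofReal_mul (by positivity),
          ← ENNReal.ofReal_add (by positivity) (by positivity)]
    _ ≤ _ := by
        refine ENNReal.ofReal_le_ofReal ?_
        have e1 : c * (1 + u) ^ k =
            4 ^ k * ((1 + u) ^ k * ((1 + s) / (1 + (u + s))) ^ k) := by
          rw [hc, mul_rpow (by positivity) (by positivity)]; ring
        have e2 : d * (1 + s) ^ k = c * (1 + u) ^ k := by
          rw [hc, hd, ← mul_rpow (by positivity) (by positivity),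
            ← mul_rpow (by positivity) (by positivity)]
          congr 1; ring
        calc _ = X * M * L * W * (c * (1 + u) ^ k + d * (1 + s) ^ k) := by ring
          _ = 2 * M * 4 ^ k * L * X *
              (W * ((1 + u) ^ k * ((1 + s) / (1 + (u + s))) ^ k)) := by
              rw [e2, e1]; ring
          _ ≤ 2 * M * 4 ^ k * L * X * ((2 ^ α + 2 ^ β) *
              ((1 + (u + s)) ^ (-α) * (1 + s) ^ (-(β - k)) +
                (1 + (u + s)) ^ (-β) * (1 + u) ^ (-(α - k)))) := by
              exact mul_le_mul_of_nonneg_left (time_weight_le hk0 hα hβ hu hs) (by positivity)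
          _ = _ := by ring

lemma integral_Icc_time_weight (a b A B t : ℝ) (ht : 0 ≤ t) :
    IntegrableOn (fun s : ℝ => A * (1 + s) ^ (-b) + B * (1 + (t - s)) ^ (-a)) (Set.Icc 0 t) ∧
    ∫ s in Set.Icc 0 t, (A * (1 + s) ^ (-b) + B * (1 + (t - s)) ^ (-a)) =
      A * Gam b t + B * Gam a t := by
  have c1 : ContinuousOn (fun s : ℝ => (1 + s) ^ (-b)) (Set.Icc 0 t) :=
    ContinuousOn.rpow_const (by fun_prop) fun s hs => Or.inl (by linarith [hs.1])
  have c2 : ContinuousOn (fun s : ℝ => (1 + (t - s)) ^ (-a)) (Set.Icc 0 t) :=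
    ContinuousOn.rpow_const (by fun_prop) fun s hs => Or.inl (by linarith [hs.2])
  have i1 := (c1.integrableOn_Icc (μ := volume)).const_mul A
  have i2 := (c2.integrableOn_Icc (μ := volume)).const_mul B
  refine ⟨i1.add i2, ?_⟩
  rw [integral_add i1 i2, integral_const_mul, integral_const_mul, integral_Icc_eq_integral_Ioc,
    integral_Icc_eq_integral_Ioc, ← intervalIntegral.integral_of_le ht,
    ← intervalIntegral.integral_of_le ht,
    intervalIntegral.integral_comp_sub_left (fun s : ℝ => (1 + s) ^ (-a)) t]
  simp [Gam]

/-- Coupling of two algebraic diffusive profiles: for `α, β, λ > 0` there is `C > 0`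
such that `K^{α,β}(t,x) = ∫₀ᵗ ∫_{|x-y|≤λ(t-s)} (1+t-s)^{-α} B_{3/2}(t-s,|x-y|)
  (1+s)^{-β} B₃(s,|y|) 1_{|y|≤λs} dy ds
  ≤ C ((1+t)^{-α} Γ_{β-3/2}(t) + (1+t)^{-β} Γ_{α-3/2}(t)) ln(1+t) B_{3/2}(t,|x|) 1_{|x|≤λt}`. -/
theorem profile_profile_coupling (α β lam : ℝ) (hα : 0 < α) (hβ : 0 < β)
    (hlam : 0 < lam) :
    ∃ C > (0 : ℝ), ∀ t : ℝ, 0 ≤ t → ∀ x : E3,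
      (∫⁻ s in Set.Icc (0 : ℝ) t,
          ∫⁻ y in {y : E3 | ‖x - y‖ ≤ lam * (t - s) ∧ ‖y‖ ≤ lam * s},
          ENNReal.ofReal ((1 + t - s) ^ (-α) * Bprof (3 / 2) (t - s) ‖x - y‖ *
            (1 + s) ^ (-β) * Bprof 3 s ‖y‖)) ≤
        ENNReal.ofReal (C * ((1 + t) ^ (-α) * Gam (β - 3 / 2) t +
            (1 + t) ^ (-β) * Gam (α - 3 / 2) t) * Real.log (1 + t) *
          (if ‖x‖ ≤ lam * t then Bprof (3 / 2) t ‖x‖ else 0)) := by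
  obtain ⟨C, hC, hK⟩ := exists_spatial_coupling_le hα hβ hlam
  refine ⟨C, hC, fun t ht x => ?_⟩
  split_ifs with hx
  · have hL : 0 ≤ log (1 + t) := log_nonneg (by linarith)
    have hX := Bprof_nonneg (k := 3 / 2) ‖x‖ ht
    obtain ⟨hint, hval⟩ := integral_Icc_time_weight (α - 3 / 2) (β - 3 / 2)
      ((1 + t) ^ (-α)) ((1 + t) ^ (-β)) t ht
    calc _ ≤ ∫⁻ s in Set.Icc (0 : ℝ) t, ENNReal.ofReal (C * log (1 + t) * Bprof (3 / 2) t ‖x‖ *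
          ((1 + t) ^ (-α) * (1 + s) ^ (-(β - 3 / 2)) +
            (1 + t) ^ (-β) * (1 + (t - s)) ^ (-(α - 3 / 2)))) := by
          refine setLIntegral_mono' measurableSet_Icc fun s hs => ?_
          have h := hK (t - s) s (by linarith [hs.2]) hs.1 x
          simpa only [sub_add_cancel, ← add_sub_assoc] using h
      _ = ENNReal.ofReal (∫ s in Set.Icc (0 : ℝ) t, C * log (1 + t) * Bprof (3 / 2) t ‖x‖ *
          ((1 + t) ^ (-α) * (1 + s) ^ (-(β - 3 / 2)) +
            (1 + t) ^ (-β) * (1 + (t - s)) ^ (-(α - 3 / 2)))) := by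
          refine (ofReal_integral_eq_lintegral_ofReal (hint.const_mul _) ?_).symm
          refine (ae_restrict_iff' measurableSet_Icc).2 (Filter.Eventually.of_forall fun s hs => ?_)
          have h1 : 0 ≤ 1 + s := by linarith [hs.1]
          have h2 : 0 ≤ 1 + (t - s) := by linarith [hs.2]
          simp only [Pi.zero_apply]
          positivity
      _ = _ := by
          rw [integral_const_mul, hval]
          congr 1
          ring
  · have hempty : ∀ s : ℝ,
        {y : E3 | ‖x - y‖ ≤ lam * (t - s) ∧ ‖y‖ ≤ lam * s} = ∅ := by
      intro s
      ext y
      simp only [Set.mem_ofPred_eq, Set.mem_empty_iff_false, iff_false, not_and]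
      intro h1 h2
      have hz : ‖x‖ ≤ ‖x - y‖ + ‖y‖ := by simpa using norm_add_le (x - y) y
      exact hx (by linarith)
    simp [hempty]

end
end

section
/- Let c > 0, let l be a positive integer and let C > 0. There exists a constant C₁ > 0 such that for all t > 0 and all x ∈ ℝ³, (t/(4π)) ∫_{S²} (1+t)^{−l/2} e^{−|x − ctω|²/(C(1+t))} dσ(ω) ≤ C₁ (1+t)^{−l/2} e^{−(|x|−ct)²/(3C(1+t))}, where dσ is the surface measure on the unit sphere S² ⊂ ℝ³ (total mass 4π). -/
open MeasureTheory Real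
open scoped ENNReal

noncomputable section

/-- Comparison of an integral over the unit sphere with an integral over the ambient space: if `F`
is dominated by `G` along the radii of the unit ball, then `∫ F ≤ dim E * ∫ G`. -/
lemma integral_toSphere_le_finrank_mul_integral {E : Type*} [NormedAddCommGroup E]
    [NormedSpace ℝ E] [MeasurableSpace E] [BorelSpace E] [FiniteDimensional ℝ E] [Nontrivial E]
    (μ : Measure E) [μ.IsAddHaarMeasure] {F : Metric.sphere (0 : E) 1 → ℝ} {G : E → ℝ}
    (hF : ∀ ω, 0 ≤ F ω) (hG : ∀ y, 0 ≤ G y) (hGi : Integrable G μ)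
    (hFG : ∀ (ω : Metric.sphere (0 : E) 1) (r : ℝ), 0 < r → r < 1 → F ω ≤ G (r • (ω : E))) :
    ∫ ω, F ω ∂μ.toSphere ≤ Module.finrank ℝ E * ∫ y, G y ∂μ := by
  set n := Module.finrank ℝ E
  have hn0 : 0 < n := Module.finrank_pos
  let I : Set.Ioi (0 : ℝ) := ⟨1, Set.mem_Ioi.2 one_pos⟩
  have hmass : ∫ r : Set.Ioi (0 : ℝ), (Set.Iio I).indicator (fun _ ↦ (1 : ℝ)) r
      ∂Measure.volumeIoiPow (n - 1) = 1 / n := by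
    rw [integral_indicator measurableSet_Iio, setIntegral_const, measureReal_def,
      Measure.volumeIoiPow_apply_Iio, ENNReal.toReal_ofReal (by positivity)]
    simp [I, Nat.cast_pred hn0]
  have hprod : (∫ ω, F ω ∂μ.toSphere) * (1 / n) =
      ∫ y : ({0}ᶜ : Set E), F (homeomorphUnitSphereProd E y).1 *
        (Set.Iio I).indicator (fun _ ↦ (1 : ℝ)) (homeomorphUnitSphereProd E y).2
        ∂(μ.comap (↑)) := by
    rw [← hmass, ← integral_prod_mul,
      ← μ.measurePreserving_homeomorphUnitSphereProd.integral_comp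
        (Homeomorph.measurableEmbedding _)]
  have hle : (∫ ω, F ω ∂μ.toSphere) * (1 / n) ≤ ∫ y, G y ∂μ := by
    have hGint : ∫ y, G y ∂μ = ∫ y : ({0}ᶜ : Set E), G y ∂(μ.comap (↑)) := by
      rw [integral_subtype_comap (measurableSet_singleton _).compl G, restrict_compl_singleton]
    rw [hprod, hGint]
    refine integral_mono_of_nonneg (.of_forall fun y ↦ ?_) ?_ (.of_forall fun y ↦ ?_)
    · exact mul_nonneg (hF _) (Set.indicator_nonneg (fun _ _ ↦ zero_le_one) _)
    · exact (integrableOn_iff_comap_subtypeVal (measurableSet_singleton (0 : E)).compl).1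
        hGi.integrableOn
    · dsimp only
      by_cases hy : (homeomorphUnitSphereProd E y).2 ∈ Set.Iio I
      · rw [Set.indicator_of_mem hy, mul_one]
        have h := hFG (homeomorphUnitSphereProd E y).1 (homeomorphUnitSphereProd E y).2
          (homeomorphUnitSphereProd E y).2.2 hy
        have hpolar : ((homeomorphUnitSphereProd E y).2 : ℝ) •
            ((homeomorphUnitSphereProd E y).1 : E) = y :=
          congrArg Subtype.val ((homeomorphUnitSphereProd E).symm_apply_apply y)
        rwa [hpolar] at h
      · rw [Set.indicator_of_notMem hy, mul_zero]
        exact hG _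
  have hn' : (0 : ℝ) < n := by exact_mod_cast hn0
  rwa [mul_one_div, div_le_iff₀' hn'] at hle

lemma exists_orthonormalBasis_apply_zero_eq {e : E3} (he : ‖e‖ = 1) :
    ∃ b : OrthonormalBasis (Fin 3) ℝ E3, b 0 = e := by
  have hv : Orthonormal ℝ (({0} : Set (Fin 3)).domRestrict fun _ ↦ e) :=
    ⟨fun _ ↦ he, fun i j hij ↦ (hij (Subsingleton.elim i j)).elim⟩
  obtain ⟨b, hb⟩ := hv.exists_orthonormalBasis_extension_of_card_eq (by simp)
  exact ⟨b, hb 0 rfl⟩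

/-- Gaussian decay of order `1 / k` of the exponential concentrated near a point of `S²`. -/
lemma integral_toSphere_exp_neg_one_sub_inner_le {e : E3} (he : ‖e‖ = 1) {k : ℝ} (hk : 0 < k) :
    ∫ ω : Metric.sphere (0 : E3) 1, exp (-(k * (1 - inner ℝ e (ω : E3))))
      ∂(volume : Measure E3).toSphere ≤ 12 * π / k := by
  obtain ⟨b, rfl⟩ := exists_orthonormalBasis_apply_zero_eq he
  let g : Fin 3 → ℝ → ℝ := ![(Set.Icc (-1) 1).indicator fun _ ↦ 1,
    fun s ↦ exp (-(k / 2) * s ^ 2), fun s ↦ exp (-(k / 2) * s ^ 2)]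
  have hg0 : ∀ i s, 0 ≤ g i s := by
    intro i s
    fin_cases i
    · exact Set.indicator_nonneg (fun _ _ ↦ zero_le_one) _
    · exact (exp_pos _).le
    · exact (exp_pos _).le
  have hgi : ∀ i, Integrable (g i) := by
    intro i
    fin_cases i
    · exact (integrable_indicator_iff measurableSet_Icc).2 (integrableOn_const (by simp))
    · exact integrable_exp_neg_mul_sq (half_pos hk)
    · exact integrable_exp_neg_mul_sq (half_pos hk)
  have hmp : MeasurePreserving (fun y : E3 ↦ WithLp.ofLp (b.repr y)) volume volume :=
    (PiLp.volume_preserving_ofLp (Fin 3)).comp b.measurePreserving_repr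
  have hemb : MeasurableEmbedding (fun y : E3 ↦ WithLp.ofLp (b.repr y)) :=
    (MeasurableEquiv.toLp 2 (Fin 3 → ℝ)).symm.measurableEmbedding.comp
      b.measurableEquiv.measurableEmbedding
  have hint : ∫ y : E3, ∏ i, g i (b.repr y i) = 4 * π / k := by
    rw [hmp.integral_comp hemb (fun z ↦ ∏ i, g i (z i)), integral_fintype_prod_volume_eq_prod,
      Fin.prod_univ_three]
    have h0 : ∫ s, g 0 s = 2 := by
      change ∫ s, (Set.Icc (-1 : ℝ) 1).indicator (fun _ ↦ (1 : ℝ)) s = 2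
      rw [integral_indicator measurableSet_Icc]
      norm_num
    have h1 : ∫ s, g 1 s = √(π / (k / 2)) := integral_gaussian _
    have h2 : ∫ s, g 2 s = √(π / (k / 2)) := integral_gaussian _
    rw [h0, h1, h2, mul_assoc, mul_self_sqrt (by positivity)]
    field_simp
    norm_num
  have hGi : Integrable (fun y : E3 ↦ ∏ i, g i (b.repr y i)) :=
    (hmp.integrable_comp_emb hemb).2 (Integrable.fintype_prod hgi)
  refine (integral_toSphere_le_finrank_mul_integral volume (fun _ ↦ (exp_pos _).le)
    (fun y ↦ Finset.prod_nonneg fun i _ ↦ hg0 i _) hGi fun ω r hr0 hr1 ↦ ?_).trans_eq ?_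
  · have hω : ∑ i, (b.repr (ω : E3) i) ^ 2 = 1 := by
      have h := EuclideanSpace.norm_sq_eq (b.repr (ω : E3))
      rw [b.repr.norm_map, norm_eq_of_mem_sphere ω] at h
      simpa using h.symm
    rw [Fin.sum_univ_three] at hω
    rw [← b.repr_apply_apply, Fin.prod_univ_three]
    simp only [map_smul, PiLp.smul_apply, smul_eq_mul]
    set u := b.repr (ω : E3) 0
    set v := b.repr (ω : E3) 1
    set w := b.repr (ω : E3) 2
    have hu : |u| ≤ 1 := abs_le_one_iff_mul_self_le_one.2 (by nlinarith [sq_nonneg v, sq_nonneg w])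
    have hru : r * u ∈ Set.Icc (-1 : ℝ) 1 := by
      rw [Set.mem_Icc, ← abs_le, abs_mul, abs_of_pos hr0]
      exact mul_le_one₀ hr1.le (abs_nonneg _) hu
    have hg : g 0 (r * u) * g 1 (r * v) * g 2 (r * w) =
        exp (-(k / 2) * (r * v) ^ 2 + -(k / 2) * (r * w) ^ 2) := by
      change (Set.Icc (-1 : ℝ) 1).indicator (fun _ ↦ (1 : ℝ)) (r * u) *
        exp (-(k / 2) * (r * v) ^ 2) * exp (-(k / 2) * (r * w) ^ 2) = _
      rw [Set.indicator_of_mem hru, one_mul, exp_add]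
    rw [hg, exp_le_exp]
    have hr2 : r ^ 2 ≤ 1 := pow_le_one₀ hr0.le hr1.le
    have hkey : r ^ 2 * (v ^ 2 + w ^ 2) ≤ 2 * (1 - u) := by
      nlinarith [mul_le_mul_of_nonneg_right hr2 (add_nonneg (sq_nonneg v) (sq_nonneg w)),
        sq_nonneg (1 - u)]
    nlinarith [mul_le_mul_of_nonneg_left hkey hk.le]
  · rw [hint]
    simp
    ring

lemma integral_toSphere_gaussian_le (x : E3) {a d : ℝ} (ha : 0 ≤ a) (hd : 0 < d) :
    ∫ ω : Metric.sphere (0 : E3) 1, exp (-‖x - a • (ω : E3)‖ ^ 2 / d)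
      ∂(volume : Measure E3).toSphere ≤
      (volume : Measure E3).toSphere.real Set.univ * exp (-((‖x‖ - a) ^ 2 / d)) := by
  rw [← smul_eq_mul, ← integral_const]
  refine integral_mono_of_nonneg (.of_forall fun _ ↦ (exp_pos _).le) (integrable_const _)
    (.of_forall fun ω ↦ ?_)
  dsimp only
  rw [exp_le_exp, neg_div, neg_le_neg_iff]
  gcongr ?_ / d
  have h := abs_norm_sub_norm_le x (a • (ω : E3))
  rw [norm_smul, norm_eq_of_mem_sphere ω, mul_one, norm_of_nonneg ha] at h
  exact sq_le_sq' (neg_le_of_abs_le h) (le_of_abs_le h)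

lemma integral_toSphere_gaussian_le_of_pos {x : E3} (hx : 0 < ‖x‖) {a d : ℝ} (ha : 0 < a)
    (hd : 0 < d) :
    ∫ ω : Metric.sphere (0 : E3) 1, exp (-‖x - a • (ω : E3)‖ ^ 2 / d)
      ∂(volume : Measure E3).toSphere ≤
      6 * π * d / (‖x‖ * a) * exp (-((‖x‖ - a) ^ 2 / d)) := by
  have he : ‖‖x‖⁻¹ • x‖ = 1 := by
    rw [norm_smul, norm_inv, norm_norm, inv_mul_cancel₀ hx.ne']
  have h := integral_toSphere_exp_neg_one_sub_inner_le he (k := 2 * ‖x‖ * a / d) (by positivity)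
  have hfactor : ∀ ω : Metric.sphere (0 : E3) 1, exp (-‖x - a • (ω : E3)‖ ^ 2 / d) =
      exp (-(2 * ‖x‖ * a / d * (1 - inner ℝ (‖x‖⁻¹ • x) (ω : E3)))) *
        exp (-((‖x‖ - a) ^ 2 / d)) := by
    intro ω
    rw [← exp_add, norm_sub_sq_real, norm_smul, norm_eq_of_mem_sphere ω, mul_one,
      norm_of_nonneg ha.le, real_inner_smul_right, real_inner_smul_left]
    congr 1
    field_simp
    ring
  simp_rw [hfactor]
  rw [integral_mul_const]
  refine mul_le_mul_of_nonneg_right (h.trans_eq ?_) (exp_pos _).le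
  field_simp
  norm_num

/-- Kirchhoff's formula estimate: the wave propagator applied to a Gaussian stays
Gaussian around the light cone,
`(t/(4π)) ∫_{S²} (1+t)^{-l/2} e^{-|x-ctω|²/(C(1+t))} dσ(ω)
  ≤ C₁ (1+t)^{-l/2} e^{-(|x|-ct)²/(3C(1+t))}`,
where `dσ` is the surface measure of the unit sphere `S² ⊆ ℝ³` (total mass `4π`). -/
theorem kirchhoff_gaussian_bound (c : ℝ) (hc : 0 < c) (l : ℕ) (hl : 0 < l)
    (C : ℝ) (hC : 0 < C) :
    ∃ C₁ > (0 : ℝ), ∀ t : ℝ, 0 < t → ∀ x : E3,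
      (t / (4 * π)) *
          ∫ ω : Metric.sphere (0 : E3) 1,
            (1 + t) ^ (-(l : ℝ) / 2) *
              Real.exp (-‖x - (c * t) • (ω : E3)‖ ^ 2 / (C * (1 + t)))
            ∂((volume : Measure E3).toSphere) ≤
        C₁ * (1 + t) ^ (-(l : ℝ) / 2) *
          Real.exp (-(‖x‖ - c * t) ^ 2 / (3 * C * (1 + t))) := by
  set M := (volume : Measure E3).toSphere.real Set.univ
  have hM0 : 0 ≤ M := measureReal_nonneg
  set K := M + 12 * C / c ^ 2 * M + 24 * π * C / c ^ 2
  refine ⟨K / (4 * π), by positivity, fun t ht x ↦ ?_⟩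
  have hd : 0 < C * (1 + t) := by positivity
  have ha : 0 < c * t := by positivity
  set q := (‖x‖ - c * t) ^ 2 / (C * (1 + t)) with hq
  have hq0 : 0 ≤ q := by positivity
  have hsplit : exp (-q) = exp (-(2 * q / 3)) * exp (-(q / 3)) := by
    rw [← exp_add]; ring_nf
  have hexp1 : exp (-(2 * q / 3)) ≤ 1 := exp_le_one_iff.2 (by linarith)
  have htarget : exp (-(‖x‖ - c * t) ^ 2 / (3 * C * (1 + t))) = exp (-(q / 3)) := by
    rw [hq]
    congr 1
    field_simp
  set J := ∫ ω : Metric.sphere (0 : E3) 1, exp (-‖x - (c * t) • (ω : E3)‖ ^ 2 / (C * (1 + t)))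
    ∂(volume : Measure E3).toSphere
  have hJ1 : J ≤ M * exp (-q) := integral_toSphere_gaussian_le x ha.le hd
  have hp1 : 0 ≤ 12 * C / c ^ 2 * M := by positivity
  have hp2 : 0 ≤ 24 * π * C / c ^ 2 := by positivity
  have hmain : t * J ≤ K * exp (-(q / 3)) := by
    obtain ⟨A, hAK, hA⟩ : ∃ A ≤ K, t * J ≤ A * exp (-(q / 3)) := by
      rcases le_total t 1 with ht1 | ht1
      · refine ⟨M, by linarith, ?_⟩
        calc t * J ≤ t * (M * exp (-q)) := by gcongr
          _ = t * exp (-(2 * q / 3)) * (M * exp (-(q / 3))) := by rw [hsplit]; ring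
          _ ≤ 1 * (M * exp (-(q / 3))) := by
            gcongr
            exact mul_le_one₀ ht1 (exp_pos _).le hexp1
          _ = _ := one_mul _
      rcases le_total ‖x‖ (c * t / 2) with hx | hx
      · refine ⟨12 * C / c ^ 2 * M, by linarith, ?_⟩
        have hqt : c ^ 2 * t / (8 * C) ≤ q := by
          rw [hq, div_le_div_iff₀ (by positivity) hd]
          have h1 : (c * t / 2) ^ 2 ≤ (‖x‖ - c * t) ^ 2 := by
            rw [← neg_sub (c * t), neg_sq]
            gcongr
            linarith
          have h2 : c ^ 2 * t * (C * (1 + t)) ≤ c ^ 2 * t * (C * (t + t)) := by gcongr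
          nlinarith [mul_le_mul_of_nonneg_right h1 (by positivity : 0 ≤ 8 * C)]
        have hy : 2 * q / 3 * exp (-(2 * q / 3)) ≤ 1 := by
          rw [exp_neg, ← div_eq_mul_inv, div_le_one (exp_pos _)]
          linarith [add_one_le_exp (2 * q / 3)]
        have htq : t ≤ 12 * C / c ^ 2 * (2 * q / 3) := by
          calc t = 12 * C / c ^ 2 * (2 * (c ^ 2 * t / (8 * C)) / 3) := by field_simp; norm_num
            _ ≤ _ := by gcongr
        calc t * J ≤ t * (M * exp (-q)) := by gcongr
          _ = t * exp (-(2 * q / 3)) * (M * exp (-(q / 3))) := by rw [hsplit]; ring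
          _ ≤ 12 * C / c ^ 2 * (2 * q / 3) * exp (-(2 * q / 3)) * (M * exp (-(q / 3))) := by
            gcongr
          _ = 12 * C / c ^ 2 * (2 * q / 3 * exp (-(2 * q / 3))) * (M * exp (-(q / 3))) := by ring
          _ ≤ 12 * C / c ^ 2 * 1 * (M * exp (-(q / 3))) := by gcongr
          _ = _ := by ring
      · refine ⟨24 * π * C / c ^ 2, by linarith, ?_⟩
        have hx0 : 0 < ‖x‖ := lt_of_lt_of_le (by positivity) hx
        have hJ2 : J ≤ 6 * π * (C * (1 + t)) / (‖x‖ * (c * t)) * exp (-q) :=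
          integral_toSphere_gaussian_le_of_pos hx0 ha hd
        calc t * J ≤ t * (6 * π * (C * (1 + t)) / (‖x‖ * (c * t)) * exp (-q)) := by gcongr
          _ ≤ t * (6 * π * (C * (t + t)) / (c * t / 2 * (c * t)) * exp (-(q / 3))) := by
            gcongr
            linarith
          _ = _ := by field_simp; norm_num
    exact hA.trans (by gcongr)
  rw [integral_const_mul, htarget]
  calc t / (4 * π) * ((1 + t) ^ (-(l : ℝ) / 2) * J)
      = (1 + t) ^ (-(l : ℝ) / 2) / (4 * π) * (t * J) := by ring
    _ ≤ (1 + t) ^ (-(l : ℝ) / 2) / (4 * π) * (K * exp (-(q / 3))) := by gcongr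
    _ = _ := by ring

end
end
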